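/- arXiv:2004.12781 — 2 statements merged into one kernel-verified Lean document; each statement's English description precedes it below -/
import Mathlib

section
/- Let 0 < φ₂ < φ₁ < π/2 and define Δσ(φ') = arccos(sin φ' · sin φ₂ + cos φ' · cos φ₂ · (tan φ₂ / tan φ₁)). Then Δσ is strictly decreasing on the interval [0, φ₁]: for all 0 ≤ a < b ≤ φ₁ one has Δσ(b) < Δσ(a). In particular Δσ attains its minimum over [0, φ₁] uniquely at φ' = φ₁. -/
open Real

/-- The cosine of the central angle is a positive multiple of `cos (φ₁ - x)`. -/
lemma central_angle_cos_eq {φ₁ φ₂ : ℝ} (hs : sin φ₁ ≠ 0) (hc₂ : cos φ₂ ≠ 0) (x : ℝ) :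
    sin x * sin φ₂ + cos x * cos φ₂ * (tan φ₂ / tan φ₁) =
      sin φ₂ / sin φ₁ * cos (φ₁ - x) := by
  rw [cos_sub, tan_eq_sin_div_cos, tan_eq_sin_div_cos]
  field_simp
  ring

/-- For `0 < φ₂ < φ₁ < π/2`, the central-angle function
`Δσ(φ') = arccos (sin φ' · sin φ₂ + cos φ' · cos φ₂ · (tan φ₂ / tan φ₁))`
is strictly decreasing on `[0, φ₁]`; in particular it attains its minimum over
`[0, φ₁]` uniquely at `φ' = φ₁`. -/
theorem central_angle_strictAntiOn (φ₁ φ₂ : ℝ)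
    (h₂ : 0 < φ₂) (h₂₁ : φ₂ < φ₁) (h₁ : φ₁ < π / 2) :
    StrictAntiOn
      (fun φ' => arccos (sin φ' * sin φ₂ + cos φ' * cos φ₂ * (tan φ₂ / tan φ₁)))
      (Set.Icc 0 φ₁) ∧
    ∀ x ∈ Set.Icc (0 : ℝ) φ₁, x ≠ φ₁ →
      arccos (sin φ₁ * sin φ₂ + cos φ₁ * cos φ₂ * (tan φ₂ / tan φ₁)) <
        arccos (sin x * sin φ₂ + cos x * cos φ₂ * (tan φ₂ / tan φ₁)) := by
  have hs₂ : 0 < sin φ₂ := sin_pos_of_pos_of_lt_pi h₂ (by linarith)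
  have hs₁ : 0 < sin φ₁ := sin_pos_of_pos_of_lt_pi (by linarith) (by linarith)
  have hc₂ : 0 < cos φ₂ := cos_pos_of_mem_Ioo ⟨by linarith, by linarith⟩
  have hlt : sin φ₂ < sin φ₁ := sin_lt_sin_of_lt_of_le_pi_div_two (by linarith) h₁.le h₂₁
  have hk : 0 < sin φ₂ / sin φ₁ := div_pos hs₂ hs₁
  have hk₁ : sin φ₂ / sin φ₁ ≤ 1 := (div_le_one hs₁).2 hlt.le
  have anti : StrictAntiOn
      (fun φ' => arccos (sin φ' * sin φ₂ + cos φ' * cos φ₂ * (tan φ₂ / tan φ₁)))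
      (Set.Icc 0 φ₁) := by
    rintro a ⟨ha, -⟩ b ⟨-, hb⟩ hab
    simp only [central_angle_cos_eq hs₁.ne' hc₂.ne']
    have hcos : cos (φ₁ - a) < cos (φ₁ - b) :=
      cos_lt_cos_of_nonneg_of_le_pi (by linarith) (by linarith) (by linarith)
    have hcos₀ : 0 ≤ cos (φ₁ - a) := cos_nonneg_of_mem_Icc ⟨by linarith, by linarith⟩
    refine arccos_lt_arccos ?_ (mul_lt_mul_of_pos_left hcos hk) ?_
    · linarith [mul_nonneg hk.le hcos₀]
    · exact mul_le_one₀ hk₁ (hcos₀.trans hcos.le) (cos_le_one _)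
  refine ⟨anti, fun x hx hne => ?_⟩
  exact anti hx ⟨by linarith, le_rfl⟩ (lt_of_le_of_ne hx.2 hne)
end

section
/- Let 0 < φ₂ < φ₁ < π/2, let θ₂ ∈ ℝ, set θ₁ = θ₂ − arccos(tan φ₂ / tan φ₁), and let θ₀ ≤ θ₁. Let θ, φ : [0,1] → ℝ be continuously differentiable with θ(0) = θ₀, θ(1) = θ₂ and φ(1) = φ₂, and suppose there exists s ∈ [0,1] with θ(s) = θ₁ and 0 ≤ φ(t) ≤ φ₁ for all t ∈ [0, s]. Then the coordinate length of the path satisfies ∫₀¹ √(φ'(t)² + cos²(φ(t)) θ'(t)²) dt ≥ cos(φ₁)·(θ₁ − θ₀) + arccos(sin φ₁ sin φ₂ + cos φ₁ cos φ₂ · (tan φ₂ / tan φ₁)). The right-hand side is exactly the length of the path consisting of the constant-latitude arc at latitude φ₁ from longitude θ₀ to longitude θ₁ followed by the great-circle arc from the point (θ₁, φ₁) to the point (θ₂, φ₂); hence this two-piece path, whose turning point at (θ₁, φ₁) need not be a corner point of any obstacle, is optimal among all such paths. -/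
open Real

/-- The differential of `cos φ * sin θ` is at most `√(1 - (cos φ * sin θ) ^ 2)` times the
spherical speed. -/
lemma abs_deriv_cos_mul_sin_le (θ φ a b : ℝ) :
    |-sin φ * b * sin θ + cos φ * (cos θ * a)| ≤
      √(1 - (cos φ * sin θ) ^ 2) * √(b ^ 2 + cos φ ^ 2 * a ^ 2) := by
  have hu : 1 - (cos φ * sin θ) ^ 2 = sin φ ^ 2 * sin θ ^ 2 + cos θ ^ 2 := by
    linear_combination (-sin θ ^ 2) * sin_sq_add_cos_sq φ - sin_sq_add_cos_sq θ
  rw [hu, ← sqrt_mul (by positivity)]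
  apply abs_le_sqrt
  nlinarith [sq_nonneg (sin φ * sin θ * (cos φ * a) + cos θ * b)]

/-- A path of coordinate length `L` starting on the meridian `θ = α` ends at a point whose
distance to that meridian is at most `L`. -/
lemma arcsin_cos_mul_sin_le_integral {s r α : ℝ} (hsr : s ≤ r) {θ φ θ' φ' : ℝ → ℝ}
    (hθ : ∀ t ∈ Set.Icc s r, HasDerivWithinAt θ (θ' t) (Set.Icc s r) t)
    (hφ : ∀ t ∈ Set.Icc s r, HasDerivWithinAt φ (φ' t) (Set.Icc s r) t)
    (hθ'c : ContinuousOn θ' (Set.Icc s r)) (hφ'c : ContinuousOn φ' (Set.Icc s r))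
    (hs : θ s = α) :
    arcsin (cos (φ r) * sin (θ r - α)) ≤
      ∫ t in s..r, √(φ' t ^ 2 + cos (φ t) ^ 2 * θ' t ^ 2) := by
  have hθc : ContinuousOn θ (Set.Icc s r) := fun t ht => (hθ t ht).continuousWithinAt
  have hφc : ContinuousOn φ (Set.Icc s r) := fun t ht => (hφ t ht).continuousWithinAt
  have hscaled : ∀ c ∈ Set.Ioo (0 : ℝ) 1, arcsin (c * (cos (φ r) * sin (θ r - α))) ≤
      ∫ t in s..r, √(φ' t ^ 2 + cos (φ t) ^ 2 * θ' t ^ 2) := by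
    intro c hc
    have hlt : ∀ t, (c * (cos (φ t) * sin (θ t - α))) ^ 2 < 1 := by
      intro t
      have h : (cos (φ t) * sin (θ t - α)) ^ 2 ≤ 1 := by
        rw [mul_pow]
        exact mul_le_one₀ (cos_sq_le_one _) (sq_nonneg _) (sin_sq_le_one _)
      have hc2 : c ^ 2 < 1 := by nlinarith [hc.1, hc.2]
      rw [mul_pow]
      nlinarith [sq_nonneg c]
    have key := intervalIntegral.sub_le_integral_of_hasDeriv_right_of_le hsr
      (g := fun t => arcsin (c * (cos (φ t) * sin (θ t - α))))
      (g' := fun t => 1 / √(1 - (c * (cos (φ t) * sin (θ t - α))) ^ 2) *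
        (c * (-sin (φ t) * φ' t * sin (θ t - α) + cos (φ t) * (cos (θ t - α) * θ' t))))
      (φ := fun t => √(φ' t ^ 2 + cos (φ t) ^ 2 * θ' t ^ 2))
      (continuous_arcsin.comp_continuousOn (by fun_prop)) ?_ ?_ ?_
    · simpa [hs] using key
    · intro t ht
      have hnhds : Set.Icc s r ∈ nhds t := Icc_mem_nhds ht.1 ht.2
      have hθt := (hθ t (Set.Ioo_subset_Icc_self ht)).hasDerivAt hnhds
      have hφt := (hφ t (Set.Ioo_subset_Icc_self ht)).hasDerivAt hnhds
      have hu := (hφt.cos.mul (hθt.sub_const α).sin).const_mul c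
      have hb := abs_lt.1 ((sq_lt_one_iff_abs_lt_one _).1 (hlt t))
      exact ((hasDerivAt_arcsin hb.1.ne' hb.2.ne).comp t hu).hasDerivWithinAt
    · exact ContinuousOn.integrableOn_Icc (by fun_prop)
    · intro t _
      have hpos : 0 < √(1 - (c * (cos (φ t) * sin (θ t - α))) ^ 2) :=
        sqrt_pos.2 (by linarith [hlt t])
      rw [one_div_mul_eq_div, div_le_iff₀ hpos]
      have hroot : c * √(1 - (cos (φ t) * sin (θ t - α)) ^ 2) ≤
          √(1 - (c * (cos (φ t) * sin (θ t - α))) ^ 2) := by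
        rw [← sqrt_sq hc.1.le, ← sqrt_mul (sq_nonneg c), sqrt_sq hc.1.le]
        apply sqrt_le_sqrt
        nlinarith [hc.1, hc.2]
      calc _ ≤ c * (√(1 - (cos (φ t) * sin (θ t - α)) ^ 2) *
            √(φ' t ^ 2 + cos (φ t) ^ 2 * θ' t ^ 2)) :=
            mul_le_mul_of_nonneg_left
              ((le_abs_self _).trans (abs_deriv_cos_mul_sin_le _ _ _ _)) hc.1.le
        _ = c * √(1 - (cos (φ t) * sin (θ t - α)) ^ 2) *
            √(φ' t ^ 2 + cos (φ t) ^ 2 * θ' t ^ 2) := by ring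
        _ ≤ _ := by
            rw [mul_comm (√(φ' t ^ 2 + cos (φ t) ^ 2 * θ' t ^ 2))]
            exact mul_le_mul_of_nonneg_right hroot (sqrt_nonneg _)
  have hcont : Continuous fun c : ℝ => arcsin (c * (cos (φ r) * sin (θ r - α))) :=
    continuous_arcsin.comp (by fun_prop)
  have hlim := (hcont.tendsto 1).mono_left (nhdsWithin_le_nhds (s := Set.Iio 1))
  rw [one_mul] at hlim
  exact le_of_tendsto hlim
    (Filter.eventually_of_mem (Ioo_mem_nhdsLT one_pos) hscaled)

/-- A path staying at latitudes whose cosine is at least `k ≥ 0` has coordinate length at least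
`k` times its longitude increment. -/
lemma mul_sub_le_integral_of_le_cos {a s k : ℝ} (has : a ≤ s) (hk : 0 ≤ k) {θ φ θ' φ' : ℝ → ℝ}
    (hθ : ∀ t ∈ Set.Icc a s, HasDerivWithinAt θ (θ' t) (Set.Icc a s) t)
    (hφc : ContinuousOn φ (Set.Icc a s))
    (hθ'c : ContinuousOn θ' (Set.Icc a s)) (hφ'c : ContinuousOn φ' (Set.Icc a s))
    (hcos : ∀ t ∈ Set.Icc a s, k ≤ cos (φ t)) :
    k * (θ s - θ a) ≤ ∫ t in a..s, √(φ' t ^ 2 + cos (φ t) ^ 2 * θ' t ^ 2) := by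
  have hθc : ContinuousOn θ (Set.Icc a s) := fun t ht => (hθ t ht).continuousWithinAt
  rw [mul_sub]
  refine intervalIntegral.sub_le_integral_of_hasDeriv_right_of_le has
    (g := fun t => k * θ t) (g' := fun t => k * θ' t) (by fun_prop) ?_
    (ContinuousOn.integrableOn_Icc (by fun_prop)) ?_
  · intro t ht
    exact (((hθ t (Set.Ioo_subset_Icc_self ht)).hasDerivAt
      (Icc_mem_nhds ht.1 ht.2)).const_mul k).hasDerivWithinAt
  · intro t ht
    apply le_sqrt_of_sq_le
    have h := hcos t (Set.Ioo_subset_Icc_self ht)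
    have h2 : k ^ 2 ≤ cos (φ t) ^ 2 := pow_le_pow_left₀ hk h 2
    nlinarith [mul_le_mul_of_nonneg_right h2 (sq_nonneg (θ' t)), sq_nonneg (φ' t)]

/-- The distance from `(θ₁, φ₁)` to `(θ₂, φ₂)` equals the distance from `(θ₂, φ₂)` to the meridian
`θ = θ₁` when `cos (θ₂ - θ₁) = tan φ₂ / tan φ₁`. -/
lemma arccos_eq_arcsin_cos_mul_sin {φ₁ φ₂ : ℝ} (h₂ : 0 < φ₂) (h₂₁ : φ₂ < φ₁)
    (h₁ : φ₁ < π / 2) :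
    arccos (sin φ₁ * sin φ₂ + cos φ₁ * cos φ₂ * (tan φ₂ / tan φ₁)) =
      arcsin (cos φ₂ * sin (arccos (tan φ₂ / tan φ₁))) := by
  have hs₁ : 0 < sin φ₁ := sin_pos_of_pos_of_lt_pi (by linarith) (by linarith)
  have hs₂ : 0 < sin φ₂ := sin_pos_of_pos_of_lt_pi (by linarith) (by linarith)
  have hc₁ : 0 < cos φ₁ := cos_pos_of_mem_Ioo ⟨by linarith, by linarith⟩
  have hc₂ : 0 < cos φ₂ := cos_pos_of_mem_Ioo ⟨by linarith, by linarith⟩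
  have hinner : sin φ₁ * sin φ₂ + cos φ₁ * cos φ₂ * (tan φ₂ / tan φ₁) = sin φ₂ / sin φ₁ := by
    rw [tan_eq_sin_div_cos, tan_eq_sin_div_cos]
    field_simp
    linear_combination sin_sq_add_cos_sq φ₁
  rw [hinner, arccos_eq_arcsin (by positivity), sin_arccos]
  congr 1
  nth_rewrite 1 [← sqrt_sq hc₂.le]
  rw [← sqrt_mul (sq_nonneg _)]
  congr 1
  rw [tan_eq_sin_div_cos, tan_eq_sin_div_cos]
  field_simp
  linear_combination sin φ₂ ^ 2 * sin_sq_add_cos_sq φ₁ - sin φ₁ ^ 2 * sin_sq_add_cos_sq φ₂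


/-- Quantitative content of the paper's Lemma 1. Let `0 < φ₂ < φ₁ < π/2`, set
`θ₁ = θ₂ − arccos (tan φ₂ / tan φ₁)` and let `θ₀ ≤ θ₁`.  Any `C¹` spherical path
`(θ t, φ t)`, `t ∈ [0,1]`, from longitude `θ₀` to the point `(θ₂, φ₂)` which
passes through longitude `θ₁` at some time `s` while keeping latitude in
`[0, φ₁]` up to time `s`, has coordinate length at least
`cos φ₁ · (θ₁ − θ₀) + arccos (sin φ₁ sin φ₂ + cos φ₁ cos φ₂ · (tan φ₂ / tan φ₁))`,
the length of the two-piece path following the parallel at latitude `φ₁` from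
`θ₀` to `θ₁` and then the great-circle arc from `(θ₁, φ₁)` to `(θ₂, φ₂)`; the
turning point `(θ₁, φ₁)` of this optimal path need not be a corner point. -/
theorem two_piece_path_is_optimal
    (φ₁ φ₂ θ₀ θ₁ θ₂ : ℝ)
    (h₂ : 0 < φ₂) (h₂₁ : φ₂ < φ₁) (h₁ : φ₁ < π / 2)
    (hθ₁ : θ₁ = θ₂ - arccos (tan φ₂ / tan φ₁)) (hθ₀ : θ₀ ≤ θ₁)
    (θ φ θ' φ' : ℝ → ℝ)
    (hθ : ∀ t ∈ Set.Icc (0 : ℝ) 1, HasDerivWithinAt θ (θ' t) (Set.Icc 0 1) t)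
    (hφ : ∀ t ∈ Set.Icc (0 : ℝ) 1, HasDerivWithinAt φ (φ' t) (Set.Icc 0 1) t)
    (hθ'c : ContinuousOn θ' (Set.Icc 0 1))
    (hφ'c : ContinuousOn φ' (Set.Icc 0 1))
    (hstart : θ 0 = θ₀) (hend : θ 1 = θ₂) (hlatend : φ 1 = φ₂)
    (hpass : ∃ s ∈ Set.Icc (0 : ℝ) 1, θ s = θ₁ ∧
      ∀ t ∈ Set.Icc (0 : ℝ) s, 0 ≤ φ t ∧ φ t ≤ φ₁) :
    cos φ₁ * (θ₁ - θ₀) +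
        arccos (sin φ₁ * sin φ₂ + cos φ₁ * cos φ₂ * (tan φ₂ / tan φ₁)) ≤
      ∫ t in (0 : ℝ)..1, Real.sqrt (φ' t ^ 2 + cos (φ t) ^ 2 * θ' t ^ 2) := by
  obtain ⟨s, ⟨hs0, hs1⟩, hθs, hlat⟩ := hpass
  have hl : Set.Icc 0 s ⊆ Set.Icc (0 : ℝ) 1 := Set.Icc_subset_Icc_right hs1
  have hr : Set.Icc s 1 ⊆ Set.Icc (0 : ℝ) 1 := Set.Icc_subset_Icc_left hs0
  have hφc : ContinuousOn φ (Set.Icc 0 1) := fun t ht => (hφ t ht).continuousWithinAt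
  have hspeed : ContinuousOn (fun t => √(φ' t ^ 2 + cos (φ t) ^ 2 * θ' t ^ 2))
      (Set.Icc 0 1) := by fun_prop
  have hparallel := mul_sub_le_integral_of_le_cos (θ := θ) (φ := φ) (θ' := θ') (φ' := φ') hs0
    (cos_pos_of_mem_Ioo ⟨by linarith, h₁⟩).le
    (fun t ht => (hθ t (hl ht)).mono hl) (hφc.mono hl) (hθ'c.mono hl) (hφ'c.mono hl)
    (fun t ht => cos_le_cos_of_nonneg_of_le_pi (hlat t ht).1 (by linarith) (hlat t ht).2)
  have harc := arcsin_cos_mul_sin_le_integral hs1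
    (fun t ht => (hθ t (hr ht)).mono hr) (fun t ht => (hφ t (hr ht)).mono hr)
    (hθ'c.mono hr) (hφ'c.mono hr) hθs
  rw [hθs, hstart] at hparallel
  have hdiff : θ₂ - θ₁ = arccos (tan φ₂ / tan φ₁) := by linarith
  rw [hend, hlatend, hdiff, ← arccos_eq_arcsin_cos_mul_sin h₂ h₂₁ h₁] at harc
  rw [← intervalIntegral.integral_add_adjacent_intervals
    ((hspeed.mono hl).intervalIntegrable_of_Icc hs0)
    ((hspeed.mono hr).intervalIntegrable_of_Icc hs1)]
  exact add_le_add hparallel harc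
end
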